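/- Let W : ℝ^{3×3} → [0, ∞) be differentiable at every point, frame indifferent (W(RF) = W(F) for every R ∈ SO(3) and F ∈ ℝ^{3×3}), twice continuously differentiable on an open neighborhood of SO(3), with W(R) = 0 for all R ∈ SO(3) and |DW(F)| ≤ C(|F| + 1) for all F. Let ℒ : ℝ^{3×3} → ℝ^{3×3} be given by ⟨ℒF₁, F₂⟩ = D²W(Id)[F₁, F₂]. Then for every sequence Gₙ in ℝ^{3×3} with Gₙ → G and every sequence hₙ → 0⁺, one has hₙ^{-2} DW(Id + hₙ² Gₙ) → ℒG, and ℒG = ℒ(sym G) is a symmetric matrix. -/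

import Mathlib

/- STATEMENT 13: For a stored energy `W : ℝ^{3×3} → [0,∞)` that is everywhere
differentiable, frame indifferent, C² near SO(3), vanishing on SO(3) and with
`|DW(F)| ≤ C(|F|+1)`, and for `ℒ` defined by `⟨ℒF₁, F₂⟩ = D²W(Id)[F₁,F₂]`:
for all `Gₙ → G` and `hₙ → 0⁺`, `hₙ⁻² DW(Id + hₙ²Gₙ) → ℒG`, and `ℒG = ℒ(sym G)`
is a symmetric matrix.  All norms are Frobenius norms. -/

open Matrix Filter Topology

noncomputable section

attribute [local instance]
  Matrix.frobeniusNormedAddCommGroup Matrix.frobeniusNormedSpace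

abbrev Mat3 := Matrix (Fin 3) (Fin 3) ℝ

/-- The special orthogonal group SO(3). -/
def SO3 : Set Mat3 := {R | Rᵀ * R = 1 ∧ R.det = 1}

/-- The Frobenius inner product `A : B = Σᵢⱼ Aᵢⱼ Bᵢⱼ`. -/
def finner (A B : Mat3) : ℝ := ∑ i, ∑ j, A i j * B i j

/-- The symmetric part of a matrix. -/
def symPart (M : Mat3) : Mat3 := (1 / 2 : ℝ) • (M + Mᵀ)

theorem finner_single (A : Mat3) (i j : Fin 3) :
    finner A (Matrix.single i j 1) = A i j := by
  fin_cases i <;> fin_cases j <;> simp [finner, Fin.sum_univ_three, Matrix.single]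

theorem exp_skew_mem (A : Mat3) (hA : Aᵀ = -A) : NormedSpace.exp A ∈ SO3 := by
  have key : ∀ B : Mat3, Bᵀ = -B → (NormedSpace.exp B)ᵀ * NormedSpace.exp B = 1 := by
    intro B hB
    rw [← Matrix.exp_transpose, hB, ← Matrix.exp_add_of_commute _ _ (Commute.neg_left (Commute.refl B))]
    simp
  refine ⟨key A hA, ?_⟩
  have h2 : NormedSpace.exp A = NormedSpace.exp ((1/2:ℝ) • A) * NormedSpace.exp ((1/2:ℝ) • A) := by
    rw [← Matrix.exp_add_of_commute _ _ (Commute.refl _), ← add_smul]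
    norm_num
  have h3 := congrArg Matrix.det (key ((1/2:ℝ) • A) (by rw [Matrix.transpose_smul, hA, smul_neg]))
  rw [Matrix.det_mul, Matrix.det_transpose, Matrix.det_one] at h3
  rw [h2, Matrix.det_mul, h3]

theorem deriv_along {E F : Type*} [NormedAddCommGroup E] [NormedSpace ℝ E]
    [NormedAddCommGroup F] [NormedSpace ℝ F] (f : E → F) (f' : E →L[ℝ] F) (c : ℝ → E) (v x : E)
    (hf : HasFDerivAt f f' x) (hc : HasDerivAt c v 0) (hx : c 0 = x)
    (h0 : ∀ t, f (c t) = 0) : f' v = 0 := by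
  subst hx
  have h := hf.comp_hasDerivAt (0:ℝ) hc
  have h1 : (f ∘ c) = fun _ => 0 := funext h0
  rw [h1] at h
  exact h.unique (hasDerivAt_const _ _)

theorem deriv_along_fderiv {E : Type*} [NormedAddCommGroup E] [NormedSpace ℝ E]
    (W : E → ℝ) (D : E →L[ℝ] (E →L[ℝ] ℝ)) (c : ℝ → E) (v x : E)
    (hf : HasFDerivAt (fderiv ℝ W) D x) (hc : HasDerivAt c v 0) (hx : c 0 = x)
    (h0 : ∀ t, fderiv ℝ W (c t) = 0) : D v = 0 :=
  deriv_along (fderiv ℝ W) D c v x hf hc hx h0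

theorem exp_curve (A : Mat3) :
    HasDerivAt (fun t : ℝ => NormedSpace.exp (t • A)) A 0 := by
  let _ : NormedRing Mat3 := Matrix.frobeniusNormedRing
  let _ : NormedAlgebra ℝ Mat3 := Matrix.frobeniusNormedAlgebra
  have := hasDerivAt_exp_smul_const (𝕂 := ℝ) A (0:ℝ)
  simp only [zero_smul, NormedSpace.exp_zero, one_mul] at this
  exact this

theorem rescaled_stress_linearization
    (W : Mat3 → ℝ) (DW : Mat3 → Mat3) (L : Mat3 → Mat3) (C : ℝ) (hC : 0 < C)
    (hpos : ∀ F : Mat3, 0 ≤ W F)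
    (hdiff : Differentiable ℝ W)
    (hDW : ∀ F H : Mat3, fderiv ℝ W F H = finner (DW F) H)
    (hfi : ∀ R ∈ SO3, ∀ F : Mat3, W (R * F) = W F)
    (U : Set Mat3) (hU : IsOpen U) (hSOU : SO3 ⊆ U) (hC2 : ContDiffOn ℝ 2 W U)
    (hSO : ∀ R ∈ SO3, W R = 0)
    (hgrowth : ∀ F : Mat3, ‖DW F‖ ≤ C * (‖F‖ + 1))
    (hL : ∀ F₁ F₂ : Mat3, finner (L F₁) F₂ = fderiv ℝ (fderiv ℝ W) 1 F₁ F₂)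
    (Gseq : ℕ → Mat3) (G : Mat3) (hG : Tendsto Gseq atTop (nhds G))
    (hseq : ℕ → ℝ) (hhpos : ∀ n, 0 < hseq n) (hh0 : Tendsto hseq atTop (nhds 0)) :
    Tendsto (fun n => (hseq n ^ 2)⁻¹ • DW (1 + hseq n ^ 2 • Gseq n)) atTop (nhds (L G)) ∧
      L G = L (symPart G) ∧ (L G)ᵀ = L G := by
  have h1 : (1 : Mat3) ∈ SO3 := by simp [SO3]
  have hcrit : ∀ R ∈ SO3, fderiv ℝ W R = 0 := by
    intro R hR
    apply IsLocalMin.fderiv_eq_zero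
    refine Filter.Eventually.of_forall fun F => ?_
    rw [hSO R hR]; exact hpos F
  have hCA : ContDiffAt ℝ 2 W 1 := hC2.contDiffAt (hU.mem_nhds (hSOU h1))
  have hD : HasFDerivAt (fderiv ℝ W) (fderiv ℝ (fderiv ℝ W) 1) 1 :=
    ((hCA.fderiv_right (m := 1) (by norm_num)).differentiableAt (by norm_num)).hasFDerivAt
  have hsymm : ∀ A B, fderiv ℝ (fderiv ℝ W) 1 A B = fderiv ℝ (fderiv ℝ W) 1 B A :=
    fun A B => (hCA.isSymmSndFDerivAt (by simp)) A B
  have hskew : ∀ A : Mat3, Aᵀ = -A → fderiv ℝ (fderiv ℝ W) 1 A = 0 := by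
    intro A hA
    have hc := exp_curve A
    refine deriv_along_fderiv (E := Mat3) W _ _ A 1 hD hc ?_ fun t => ?_
    · rw [zero_smul, NormedSpace.exp_zero]
    · exact hcrit _ (exp_skew_mem _ (by rw [Matrix.transpose_smul, hA, smul_neg]))
  have hLc : ∀ F i j, L F i j = fderiv ℝ (fderiv ℝ W) 1 F (Matrix.single i j 1) := by
    intro F i j
    rw [← hL, finner_single]
  have hDc : ∀ F i j, DW F i j = fderiv ℝ W F (Matrix.single i j 1) := by
    intro F i j
    rw [hDW, finner_single]
  refine ⟨?_, ?_, ?_⟩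
  · have hc : Tendsto (fun n => hseq n ^ 2) atTop (𝓝 0) := by
      simpa using hh0.pow 2
    have hlim : Tendsto (fun n => (hseq n ^ 2)⁻¹ •
        (fderiv ℝ W (1 + hseq n ^ 2 • Gseq n) - fderiv ℝ W 1)) atTop
        (𝓝 (fderiv ℝ (fderiv ℝ W) 1 G)) := by
      have hcd : Tendsto (fun n => (hseq n ^ 2)⁻¹ • (hseq n ^ 2 • Gseq n)) atTop (𝓝 G) := by
        refine hG.congr fun n => ?_
        rw [smul_smul, inv_mul_cancel₀ (pow_pos (hhpos n) 2).ne', one_smul]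
      have hd : Tendsto (fun n => hseq n ^ 2 • Gseq n) atTop (𝓝 0) := by
        simpa using hc.smul hG
      exact (hasFDerivWithinAt_univ.2 hD).lim hd (.of_forall fun _ => Set.mem_univ _) hcd
    rw [hcrit 1 h1] at hlim
    simp only [sub_zero] at hlim
    refine tendsto_pi_nhds.2 fun i => tendsto_pi_nhds.2 fun j => ?_
    rw [hLc]
    have := ((ContinuousLinearMap.apply ℝ ℝ (Matrix.single i j 1 : Mat3)).continuous.tendsto _).comp hlim
    refine this.congr fun n => ?_
    change (hseq n ^ 2)⁻¹ * fderiv ℝ W (1 + hseq n ^ 2 • Gseq n) (Matrix.single i j 1) =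
      (hseq n ^ 2)⁻¹ * DW (1 + hseq n ^ 2 • Gseq n) i j
    rw [hDc]
  · ext i j
    rw [hLc, hLc]
    have hs : G = symPart G + (1/2:ℝ) • (G - Gᵀ) := by
      ext a b; simp [symPart]; ring
    conv_lhs => rw [hs]
    rw [map_add, hskew ((1/2:ℝ) • (G - Gᵀ))]
    · simp
    · ext a b; simp; ring
  · ext i j
    rw [Matrix.transpose_apply, hLc, hLc, ← sub_eq_zero, ← map_sub, hsymm, hskew]
    · rfl
    · simp
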